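/- arXiv:1501.00426 — 2 statements merged into one kernel-verified Lean document; each statement's English description precedes it below -/
import Mathlib

section
/- Every meromorphic germ at zero on ℂ^k with linear poles, i.e., a germ f such that f · Π_{i=1}^n L_i is holomorphic at zero for some nonzero real linear forms L_1, ..., L_n, can be written as a finite sum f = Σ_j S_j + h, where h is a holomorphic germ at zero and each S_j is a polar germ: a germ of the form g(ℓ_1,...,ℓ_m)/(M_1^{s_1} ⋯ M_p^{s_p}) with g holomorphic at zero, M_1, ..., M_p linearly independent real linear forms, ℓ_1, ..., ℓ_m real linear forms orthogonal to all M_i with respect to the standard inner product, s_i ≥ 1, and {ℓ_1,...,ℓ_m} linearly independent. -/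
open Complex Filter Finset

noncomputable section

/-- Pairing of a real vector (regarded as a real linear form via the standard
inner product) with a complex vector in `ℂ^k`. -/
def pairC {k : ℕ} (v : Fin k → ℝ) (x : Fin k → ℂ) : ℂ := ∑ i, (v i : ℂ) * x i

/-- A polar germ at zero on `ℂ^k` (with respect to the standard inner product on `ℝ^k`):
a germ of the form `h(ℓ_1,…,ℓ_m) / (L_1^{s_1} ⋯ L_p^{s_p})` with `h` holomorphic at `0`,
`L_1,…,L_p` linearly independent real linear forms, `ℓ_1,…,ℓ_m` linearly independent real
linear forms orthogonal to all the `L_j`, and exponents `s_j ≥ 1`. -/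
structure PolarGerm (k : ℕ) where
  m : ℕ
  p : ℕ
  num : (Fin m → ℂ) → ℂ
  num_analytic : AnalyticAt ℂ num 0
  ell : Fin m → Fin k → ℝ
  L : Fin p → Fin k → ℝ
  s : Fin p → ℕ
  s_pos : ∀ j, 1 ≤ s j
  ell_indep : LinearIndependent ℝ ell
  L_indep : LinearIndependent ℝ L
  orth : ∀ i j, ∑ t, ell i t * L j t = 0

/-- Evaluation of a polar germ. -/
def PolarGerm.eval {k : ℕ} (S : PolarGerm k) (x : Fin k → ℂ) : ℂ :=
  S.num (fun i => pairC (S.ell i) x) / ∏ j, (pairC (S.L j) x) ^ S.s j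

/-- The set where the denominator of a polar germ does not vanish. -/
def PolarGerm.Dom {k : ℕ} (S : PolarGerm k) (x : Fin k → ℂ) : Prop :=
  ∀ j, pairC (S.L j) x ≠ 0

/-- The supporting cone of a polar germ: the convex cone generated by `L_1,…,L_p`. -/
def PolarGerm.cone {k : ℕ} (S : PolarGerm k) : Set (Fin k → ℝ) :=
  {v | ∃ c : Fin S.p → ℝ, (∀ j, 0 ≤ c j) ∧ v = ∑ j, c j • S.L j}

/-- The polar order (p-order) of a polar germ: the sum of the exponents. -/
def PolarGerm.pord {k : ℕ} (S : PolarGerm k) : ℕ := ∑ j, S.s j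

/-- The polar germ with its holomorphic numerator evaluated at zero: `S(0_ℓ)`. -/
def PolarGerm.eval0 {k : ℕ} (S : PolarGerm k) (x : Fin k → ℂ) : ℂ :=
  S.num 0 / ∏ j, (pairC (S.L j) x) ^ S.s j

/-- `F` is a face of the convex cone `C`. -/
def IsFaceOf {k : ℕ} (F C : Set (Fin k → ℝ)) : Prop :=
  F ⊆ C ∧ ∀ x ∈ C, ∀ y ∈ C, x + y ∈ F → x ∈ F ∧ y ∈ F

/-- The convex cone generated by a finite family of vectors. -/
def coneOf {k p : ℕ} (L : Fin p → Fin k → ℝ) : Set (Fin k → ℝ) :=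
  {v | ∃ c : Fin p → ℝ, (∀ j, 0 ≤ c j) ∧ v = ∑ j, c j • L j}

section Hadamard
variable {E : Type*} [NormedAddCommGroup E] [NormedSpace ℂ E]

/-- Telescoping series: the divided-difference series of `p` between `x` and `A x`, direction `u`. -/
noncomputable def ddSeries (p : FormalMultilinearSeries ℂ E ℂ) (A : E →L[ℂ] E) (u : E) :
    FormalMultilinearSeries ℂ E ℂ := fun n =>
  ∑ i : Fin (n + 1), ((p (n + 1)).curryMid i u).compContinuousLinearMap
    (fun j : Fin n => if j.castSucc < i then ContinuousLinearMap.id ℂ E else A)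

theorem ddSeries_norm_le (p : FormalMultilinearSeries ℂ E ℂ) (A : E →L[ℂ] E) (u : E) (n : ℕ) :
    ‖ddSeries p A u n‖ ≤ (n + 1) * (‖p (n + 1)‖ * ‖u‖ * (max 1 ‖A‖) ^ n) := by
  unfold ddSeries
  refine (norm_sum_le _ _).trans ?_
  have : ∀ i : Fin (n + 1), ‖((p (n + 1)).curryMid i u).compContinuousLinearMap
    (fun j : Fin n => if j.castSucc < i then ContinuousLinearMap.id ℂ E else A)‖ ≤
      ‖p (n + 1)‖ * ‖u‖ * (max 1 ‖A‖) ^ n := by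
    intro i
    refine (ContinuousMultilinearMap.norm_compContinuousLinearMap_le _ _).trans ?_
    refine mul_le_mul ?_ ?_ (by positivity) (by positivity)
    · refine (ContinuousLinearMap.le_opNorm _ _).trans ?_
      rw [ContinuousMultilinearMap.norm_curryMid]
    · have : (max 1 ‖A‖) ^ n = ∏ _j : Fin n, max 1 ‖A‖ := by simp
      rw [this]
      refine Finset.prod_le_prod (fun _ _ => norm_nonneg _) fun j _ => ?_
      split_ifs
      · exact ContinuousLinearMap.norm_id_le.trans (le_max_left _ _)
      · exact le_max_right _ _
  refine (Finset.sum_le_sum fun i _ => this i).trans ?_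
  simp

theorem ddSeries_radius_pos (p : FormalMultilinearSeries ℂ E ℂ) (hp : 0 < p.radius)
    (A : E →L[ℂ] E) (u : E) : 0 < (ddSeries p A u).radius := by
  obtain ⟨C, r, hC, hr, h⟩ := p.le_mul_pow_of_radius_pos hp
  set K := max 1 ‖A‖ with hK
  have hK1 : 1 ≤ K := le_max_left _ _
  have hpos : 0 < (2 * r * K)⁻¹ := by positivity
  have key : ((Real.toNNReal (2 * r * K)⁻¹ : NNReal) : ENNReal) ≤ (ddSeries p A u).radius := by
    refine FormalMultilinearSeries.le_radius_of_bound _ (C * r * ‖u‖) fun n => ?_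
    rw [Real.coe_toNNReal _ hpos.le]
    have h1 := ddSeries_norm_le p A u n
    rw [← hK] at h1
    have h2 : ((n : ℝ) + 1) ≤ 2 ^ n := by
      exact_mod_cast Nat.succ_le_of_lt (Nat.lt_two_pow_self (n := n))
    have h3 : ‖ddSeries p A u n‖ ≤ 2 ^ n * (C * r ^ (n + 1) * ‖u‖ * K ^ n) := by
      refine h1.trans ?_
      have := h (n + 1)
      gcongr
    calc _ ≤ 2 ^ n * (C * r ^ (n + 1) * ‖u‖ * K ^ n) * ((2 * r * K)⁻¹) ^ n := by
            gcongr
      _ = C * r * ‖u‖ * ((2 * r * K) * (2 * r * K)⁻¹) ^ n := by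
            rw [mul_pow, mul_pow, mul_pow]; ring
      _ ≤ _ := by rw [mul_inv_cancel₀ (by positivity)]; simp
  refine lt_of_lt_of_le ?_ key
  exact_mod_cast Real.toNNReal_pos.2 hpos

theorem multilinear_telescope {n : ℕ} (P : ContinuousMultilinearMap ℂ (fun _ : Fin (n + 1) => E) ℂ)
    (x y : E) :
    P (fun _ => x) - P (fun _ => y) =
      ∑ i : Fin (n + 1), P (i.insertNth (x - y) (fun j : Fin n => if j.castSucc < i then x else y)) := by
  let T : ℕ → ℂ := fun j => P (fun a => if a.val < j then x else y)
  have h0 : T 0 = P (fun _ => y) := by simp [T]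
  have h1 : T (n + 1) = P (fun _ => x) := by
    simp only [T]; congr 1; funext a; simp [a.isLt]
  rw [← h0, ← h1, ← Finset.sum_range_sub, Finset.sum_range]
  refine Finset.sum_congr rfl fun i _ => ?_
  have e : ∀ z : E, (i.insertNth z (fun j : Fin n => if j.castSucc < i then x else y) : Fin (n+1) → E)
      = Function.update (fun a => if a.val < i.val then x else y) i z := by
    intro z
    rw [Fin.insertNth_eq_iff]
    refine ⟨by simp, ?_⟩
    funext j
    simp only [Fin.removeNth, Function.update_of_ne (Fin.succAbove_ne i j)]
    by_cases hj : j.castSucc < i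
    · have : (j:ℕ) < i := hj
      simp [Fin.succAbove_of_castSucc_lt _ _ hj, hj, this]
    · have : ¬ (j:ℕ) < i := hj
      have h2 : ¬ (j:ℕ) + 1 < i := by omega
      rw [Fin.succAbove_of_le_castSucc _ _ (not_lt.1 hj)]; simp [hj, h2]
  rw [e, ContinuousMultilinearMap.map_update_sub]
  simp only [T]
  congr 2
  · funext a
    by_cases h : a = i
    · subst h; simp
    · have : (a:ℕ) ≠ i := fun h' => h (Fin.ext h')
      rw [Function.update_of_ne h]
      have : (a:ℕ) < i + 1 ↔ (a:ℕ) < i := by omega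
      simp [this]
  · funext a
    by_cases h : a = i
    · subst h; simp
    · rw [Function.update_of_ne h]

theorem ddSeries_apply_sum {ι : Type*} [Fintype ι] (p : FormalMultilinearSeries ℂ E ℂ)
    (A : E →L[ℂ] E) (lam : ι → ℂ) (u : ι → E) (x : E) (hx : x - A x = ∑ i, lam i • u i) (n : ℕ) :
    ∑ i, lam i * ddSeries p A (u i) n (fun _ => x) =
      p (n + 1) (fun _ => x) - p (n + 1) (fun _ => A x) := by
  rw [multilinear_telescope]
  simp only [ddSeries, _root_.sum_apply, Finset.mul_sum]
  rw [Finset.sum_comm]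
  refine Finset.sum_congr rfl fun i _ => ?_
  rw [← ContinuousMultilinearMap.curryMid_apply, hx, map_sum, _root_.sum_apply]
  refine Finset.sum_congr rfl fun v _ => ?_
  rw [map_smul, _root_.smul_apply, smul_eq_mul]
  congr 1
  rw [ContinuousMultilinearMap.compContinuousLinearMap_apply]
  congr 1
  funext j
  split_ifs <;> rfl

theorem hadamard {ι : Type*} [Fintype ι] (g : E → ℂ) (hg : AnalyticAt ℂ g 0) (A : E →L[ℂ] E)
    (lam : ι → E → ℂ) (u : ι → E) (hx : ∀ x, x - A x = ∑ i, lam i x • u i) :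
    ∃ G : ι → E → ℂ, (∀ i, AnalyticAt ℂ (G i) 0) ∧
      ∀ᶠ x in nhds (0 : E), g x = g (A x) + ∑ i, lam i x * G i x := by
  obtain ⟨p, hp⟩ := hg
  obtain ⟨r, hr⟩ := hp
  have hq : ∀ i, HasFPowerSeriesOnBall (ddSeries p A (u i)).sum (ddSeries p A (u i)) 0
      (ddSeries p A (u i)).radius := fun i =>
    (ddSeries p A (u i)).hasFPowerSeriesOnBall (ddSeries_radius_pos p hr.radius_pos A (u i))
  refine ⟨fun i => (ddSeries p A (u i)).sum, fun i => (hq i).analyticAt, ?_⟩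
  have e1 : ∀ᶠ x in nhds (0:E), x ∈ Metric.eball (0:E) r := Metric.eball_mem_nhds _ hr.r_pos
  have e2 : ∀ᶠ x in nhds (0:E), A x ∈ Metric.eball (0:E) r := by
    have : Tendsto A (nhds 0) (nhds 0) := by simpa using A.continuous.tendsto 0
    exact this (Metric.eball_mem_nhds _ hr.r_pos)
  have e3 : ∀ᶠ x in nhds (0:E), ∀ i, x ∈ Metric.eball (0:E) (ddSeries p A (u i)).radius :=
    eventually_all.2 fun i => Metric.eball_mem_nhds _ (hq i).r_pos
  filter_upwards [e1, e2, e3] with x h1 h2 h3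
  have s1 := hr.hasSum h1
  have s2 := hr.hasSum h2
  rw [zero_add] at s1 s2
  have s3 := s1.sub s2
  have s4 : HasSum (fun n => ∑ i, lam i x * ddSeries p A (u i) n (fun _ => x))
      (∑ i, lam i x * (ddSeries p A (u i)).sum x) := by
    refine hasSum_sum fun i _ => HasSum.mul_left _ ?_
    simpa using (hq i).hasSum (h3 i)
  simp only [ddSeries_apply_sum p A (fun i => lam i x) u x (hx x)] at s4
  have s5 := (hasSum_nat_add_iff' 1).2 s3
  have z : p 0 (fun _ => x) = p 0 (fun _ => A x) := by congr 1; funext j; exact j.elim0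
  simp only [Finset.sum_range_one, z, sub_self, sub_zero] at s5
  have := s4.unique s5
  rw [this]; ring
end Hadamard

theorem exists_split {k : ℕ} (s : Finset (Fin k → ℝ)) (hs : LinearIndepOn ℝ id (s : Set (Fin k → ℝ))) :
    ∃ (m : ℕ) (ell : Fin m → Fin k → ℝ), LinearIndependent ℝ ell ∧
      (∀ i, ∀ v ∈ s, ∑ t, ell i t * v t = 0) ∧
      ∃ (w : Fin m → Fin k → ℂ) (u : s → Fin k → ℂ), ∀ x : Fin k → ℂ,
        x = ∑ i, pairC (ell i) x • w i + ∑ v : s, pairC (v : Fin k → ℝ) x • u v := by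
  classical
  let φ : (Fin k → ℝ) →ₗ[ℝ] (s → ℝ) :=
    LinearMap.pi fun v => dotProductBilin ℝ ℝ (v : Fin k → ℝ)
  have hφ : ∀ y v, φ y v = ∑ t, y t * (v : Fin k → ℝ) t := by
    intro y v
    simp [φ, dotProduct, mul_comm]
  let W := LinearMap.ker φ
  let B := Module.finBasis ℝ W
  let m := Module.finrank ℝ W
  let ell : Fin m → Fin k → ℝ := fun i => (B i : Fin k → ℝ)
  have hell : LinearIndependent ℝ ell := B.linearIndependent.map' W.subtype (by simp)
  have horth : ∀ y ∈ W, ∀ v ∈ s, ∑ t, y t * v t = 0 := by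
    intro y hy v hv
    have : φ y = 0 := hy
    rw [← hφ y ⟨v, hv⟩, this]; rfl
  have hs' : LinearIndependent ℝ (fun v : s => (v : Fin k → ℝ)) := hs
  have hdisj : Disjoint (Submodule.span ℝ (Set.range ell))
      (Submodule.span ℝ (Set.range (fun v : s => (v : Fin k → ℝ)))) := by
    rw [Submodule.disjoint_def]
    intro y hy hy'
    have h1 : y ∈ W := by
      refine Submodule.span_le.2 ?_ hy
      rintro _ ⟨i, rfl⟩
      exact (B i).2
    have h2 : ∑ t, y t * y t = 0 := by
      have : ∀ z ∈ Submodule.span ℝ (Set.range (fun v : s => (v : Fin k → ℝ))), ∑ t, y t * z t = 0 := by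
        intro z hz
        induction hz using Submodule.span_induction with
        | mem z hz => obtain ⟨v, rfl⟩ := hz; exact horth y h1 v v.2
        | zero => simp
        | add a b _ _ ha hb => simp [mul_add, Finset.sum_add_distrib, ha, hb]
        | smul c a _ ha =>
          have : ∑ t, y t * (c • a) t = c * ∑ t, y t * a t := by
            rw [Finset.mul_sum]; refine Finset.sum_congr rfl fun t _ => ?_
            simp; ring
          rw [this, ha, mul_zero]
      exact this y hy'
    have h3 := (Finset.sum_eq_zero_iff_of_nonneg (fun t _ => mul_self_nonneg (y t))).1 h2
    funext t
    exact mul_self_eq_zero.1 (h3 t (Finset.mem_univ t))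
  have hsum := hell.sum_type hs' hdisj
  have hcard : Fintype.card (Fin m ⊕ s) = Module.finrank ℝ (Fin k → ℝ) := by
    refine le_antisymm hsum.fintype_card_le_finrank ?_
    have h1 := φ.finrank_range_add_finrank_ker
    have h2 : Module.finrank ℝ (LinearMap.range φ) ≤ Fintype.card s := by
      simpa using Submodule.finrank_le (LinearMap.range φ)
    rw [← h1, Fintype.card_sum, Fintype.card_fin]
    change _ + m ≤ _
    omega
  let b : Module.Basis (Fin m ⊕ s) ℝ (Fin k → ℝ) := 
    Module.Basis.mk hsum (hsum.span_eq_top_of_card_eq_finrank' hcard).ge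
  have hb : ∀ a, b a = Sum.elim ell (fun v : s => (v : Fin k → ℝ)) a := by
    intro a; simp [b]
  let w : (Fin m ⊕ s) → Fin k → ℂ := fun a t => (b.repr (Pi.single t 1) a : ℝ)
  refine ⟨m, ell, hell, fun i v hv => horth _ (B i).2 v hv, fun i => w (Sum.inl i),
    fun v => w (Sum.inr v), fun x => ?_⟩
  have main : x = ∑ a, pairC (b a) x • w a := by
    funext t
    simp only [Finset.sum_apply, Pi.smul_apply, smul_eq_mul, pairC, w, Finset.sum_mul]
    rw [Finset.sum_comm]
    have : ∀ t', ∑ a, (b a t' : ℂ) * x t' * (b.repr (Pi.single t 1) a : ℝ) =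
        ((Pi.single t (1:ℝ) : Fin k → ℝ) t' : ℝ) * x t' := by
      intro t'
      have h := congrFun (b.sum_repr (Pi.single t 1)) t'
      rw [← h]
      simp only [Finset.sum_apply, Pi.smul_apply, smul_eq_mul]
      push_cast
      rw [Finset.sum_mul]
      refine Finset.sum_congr rfl fun a _ => by ring
    rw [Finset.sum_congr rfl fun t' _ => this t']
    rw [Finset.sum_eq_single t (fun t' _ h => by simp [h]) (by simp)]
    simp
  conv_lhs => rw [main]
  rw [Fintype.sum_sum_type]
  simp [hb]

/-- The denominator attached to a multiset of forms. -/
def denC {k : ℕ} (M : Multiset (Fin k → ℝ)) (x : Fin k → ℂ) : ℂ := (M.map fun v => pairC v x).prod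

def GoodAt {k : ℕ} (A : Set (Fin k → ℝ)) (x : Fin k → ℂ) : Prop := ∀ v ∈ A, pairC v x ≠ 0

theorem denC_ne {k : ℕ} {A : Set (Fin k → ℝ)} {x : Fin k → ℂ} (hx : GoodAt A x)
    {M : Multiset (Fin k → ℝ)} (hM : ∀ v ∈ M, v ∈ A) : denC M x ≠ 0 := by
  unfold denC
  refine Multiset.prod_ne_zero fun hz => ?_
  obtain ⟨v, hv, h0⟩ := Multiset.mem_map.1 hz
  exact hx v (hM v hv) h0

theorem denC_cons {k : ℕ} (v : Fin k → ℝ) (M : Multiset (Fin k → ℝ)) (x : Fin k → ℂ) :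
    denC (v ::ₘ M) x = pairC v x * denC M x := by simp [denC]

theorem denC_erase {k : ℕ} {v : Fin k → ℝ} {M : Multiset (Fin k → ℝ)} (hv : v ∈ M) (x : Fin k → ℂ) :
    denC M x = pairC v x * denC (M.erase v) x := by
  rw [← denC_cons, Multiset.cons_erase hv]

theorem denC_add {k : ℕ} (M N : Multiset (Fin k → ℝ)) (x : Fin k → ℂ) :
    denC (M + N) x = denC M x * denC N x := by simp [denC]

theorem pairC_sum {k : ℕ} (s : Finset (Fin k → ℝ)) (c : (Fin k → ℝ) → ℝ) (x : Fin k → ℂ) :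
    pairC (∑ v ∈ s, c v • v) x = ∑ v ∈ s, (c v : ℂ) * pairC v x := by
  simp only [pairC, Finset.sum_apply, Pi.smul_apply, smul_eq_mul, Finset.mul_sum]
  push_cast
  simp only [Finset.sum_mul]
  rw [Finset.sum_comm]
  exact Finset.sum_congr rfl fun v _ => Finset.sum_congr rfl fun t _ => by ring

/-- Combinations of inverses of products of linearly independent forms. -/
inductive PFrac {k : ℕ} (A : Set (Fin k → ℝ)) : ((Fin k → ℂ) → ℂ) → Prop
  | zero : PFrac A (fun _ => 0)
  | add (f g : (Fin k → ℂ) → ℂ) : PFrac A f → PFrac A g → PFrac A (fun x => f x + g x)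
  | smul (c : ℂ) (f : (Fin k → ℂ) → ℂ) : PFrac A f → PFrac A (fun x => c * f x)
  | gen (M : Multiset (Fin k → ℝ)) : (∀ v ∈ M, v ∈ A) → LinearIndepOn ℝ id {v | v ∈ M} →
      PFrac A (fun x => (denC M x)⁻¹)
  | congr (f g : (Fin k → ℂ) → ℂ) : PFrac A f → (∀ x, GoodAt A x → f x = g x) → PFrac A g

theorem PFrac.sum {k : ℕ} {A : Set (Fin k → ℝ)} {ι : Type*} (s : Finset ι)
    (F : ι → (Fin k → ℂ) → ℂ) (h : ∀ i ∈ s, PFrac A (F i)) : PFrac A (fun x => ∑ i ∈ s, F i x) := by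
  classical
  induction s using Finset.induction_on with
  | empty => simpa using PFrac.zero
  | insert a s ha ih =>
    simp only [Finset.sum_insert ha]
    exact PFrac.add _ _ (h a (by simp)) (ih fun i hi => h i (by simp [hi]))

theorem notMem_span_of_coeff {k : ℕ} (s : Finset (Fin k → ℝ))
    (hs : LinearIndepOn ℝ id (s : Set (Fin k → ℝ)))
    (c : (Fin k → ℝ) → ℝ) (v : Fin k → ℝ) (hv : v ∈ s) (hc : c v ≠ 0) :
    ∑ w ∈ s, c w • w ∉ Submodule.span ℝ ((s : Set (Fin k → ℝ)) \ {v}) := by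
  classical
  intro h
  rw [← Finset.add_sum_erase s _ hv] at h
  have h2 : ∑ w ∈ s.erase v, c w • w ∈ Submodule.span ℝ ((s : Set (Fin k → ℝ)) \ {v}) := by
    refine Submodule.sum_mem _ fun w hw => Submodule.smul_mem _ _ (Submodule.subset_span ?_)
    rw [Finset.mem_erase] at hw
    exact ⟨hw.2, hw.1⟩
  have h3 := (Submodule.add_mem_iff_left _ h2).1 h
  have h4 := (Submodule.smul_mem_iff _ hc).1 h3
  have h5 : insert v ((s : Set (Fin k → ℝ)) \ {v}) = s := by
    rw [Set.insert_sdiff_singleton, Set.insert_eq_of_mem]; exact hv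
  rw [← h5, linearIndepOn_id_insert (by simp)] at hs
  exact hs.2 h4

theorem pfrac_dep {k : ℕ} {A : Set (Fin k → ℝ)} (L : Fin k → ℝ) (hLA : L ∈ A)
    (s : Finset (Fin k → ℝ)) (hs : LinearIndepOn ℝ id (s : Set (Fin k → ℝ)))
    (c : (Fin k → ℝ) → ℝ) (hc : L = ∑ v ∈ s, c v • v) (n : ℕ) :
    ∀ (M : Multiset (Fin k → ℝ)) (a : ℕ), M.card = n → (∀ v, v ∈ M ↔ v ∈ s) → (∀ v ∈ M, v ∈ A) →
      PFrac A (fun x => (denC (Multiset.replicate (a + 1) L + M) x)⁻¹) := by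
  classical
  induction n with
  | zero =>
    intro M a hM hMs hMA
    rw [Multiset.card_eq_zero] at hM
    subst hM
    have : s = ∅ := by
      ext v; simp [← hMs]
    subst this
    refine PFrac.congr _ _ PFrac.zero fun x hx => ?_
    exact absurd (by rw [hc]; simp [pairC]) (hx L hLA)
  | succ n ih =>
    intro M a hM hMs hMA
    have key : PFrac A (fun x => ∑ v ∈ s,
        (c v : ℂ) * (denC (Multiset.replicate (a + 1 + 1) L + M.erase v) x)⁻¹) := by
      refine PFrac.sum s _ fun v hv => ?_
      have hvM : v ∈ M := (hMs v).2 hv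
      have hMA' : ∀ w ∈ M.erase v, w ∈ A := fun w hw => hMA w (Multiset.mem_of_mem_erase hw)
      by_cases h0 : c v = 0
      · simpa [h0] using PFrac.zero
      refine PFrac.smul _ _ ?_
      by_cases hv2 : v ∈ M.erase v
      · refine ih (M.erase v) (a + 1) (by rw [Multiset.card_erase_of_mem hvM, hM]; rfl) ?_ hMA'
        intro w
        rw [← hMs]
        by_cases hw : w = v
        · subst hw; simp [hv2, hvM]
        · exact Multiset.mem_erase_of_ne hw
      · refine PFrac.gen _ ?_ ?_
        · intro w hw
          rcases Multiset.mem_add.1 hw with h | h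
          · rw [Multiset.eq_of_mem_replicate h]; exact hLA
          · exact hMA' w h
        · have hset : {w | w ∈ Multiset.replicate (a + 1 + 1) L + M.erase v} =
              insert L ((s : Set (Fin k → ℝ)) \ {v}) := by
            ext w
            simp only [Set.mem_ofPred_eq, Multiset.mem_add, Set.mem_insert_iff, Set.mem_sdiff,
              Set.mem_singleton_iff, Finset.mem_coe, ← hMs, Multiset.mem_replicate]
            by_cases hw : w = v
            · subst hw; simp [hv2]
            · rw [Multiset.mem_erase_of_ne hw]; simp [hw]
          rw [hset]
          refine (hs.mono Set.sdiff_subset).id_insert ?_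
          rw [hc]
          exact notMem_span_of_coeff s hs c v hv h0
    refine PFrac.congr _ _ key fun x hx => ?_
    have hL0 := hx L hLA
    have hM0 := denC_ne hx hMA
    have hLx : pairC L x = ∑ v ∈ s, (c v : ℂ) * pairC v x := by
      conv_lhs => rw [hc]
      exact pairC_sum s c x
    have hrep : ∀ a, denC (Multiset.replicate a L) x = pairC L x ^ a := by
      intro a; simp [denC]
    have : ∀ v ∈ s, (c v : ℂ) * (denC (Multiset.replicate (a + 1 + 1) L + M.erase v) x)⁻¹ =
        (c v : ℂ) * pairC v x * (pairC L x ^ (a + 1 + 1) * denC M x)⁻¹ := by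
      intro v hv
      have hvM : v ∈ M := (hMs v).2 hv
      have hv0 := hx v (hMA v hvM)
      rw [denC_add, hrep, denC_erase hvM]
      have he : denC (M.erase v) x ≠ 0 :=
        denC_ne hx fun w hw => hMA w (Multiset.mem_of_mem_erase hw)
      field_simp
    rw [Finset.sum_congr rfl this, ← Finset.sum_mul, ← hLx, denC_add, hrep]
    field_simp
    ring

theorem PFrac.inv_mul {k : ℕ} {A : Set (Fin k → ℝ)} (L : Fin k → ℝ) (hLA : L ∈ A)
    (f : (Fin k → ℂ) → ℂ) (hf : PFrac A f) : PFrac A (fun x => (pairC L x)⁻¹ * f x) := by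
  classical
  induction hf with
  | zero => simpa using PFrac.zero
  | add f g _ _ hf hg =>
    simp only [mul_add]; exact PFrac.add _ _ hf hg
  | smul c f _ hf =>
    simp only [mul_left_comm _ c]; exact PFrac.smul _ _ hf
  | congr f g _ h hf => exact PFrac.congr _ _ hf fun x hx => by rw [h x hx]
  | gen M hMA hM =>
    have e : (fun x => (pairC L x)⁻¹ * (denC M x)⁻¹) = fun x => (denC (L ::ₘ M) x)⁻¹ := by
      funext x; rw [denC_cons, mul_inv]
    rw [e]
    by_cases hL : L ∈ Submodule.span ℝ {v | v ∈ M}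
    · have hset : {v | v ∈ M} = (M.toFinset : Set (Fin k → ℝ)) := by ext; simp
      rw [hset] at hL hM
      obtain ⟨c, -, hc⟩ := Submodule.mem_span_finset.1 hL
      have := pfrac_dep L hLA M.toFinset hM c hc.symm _ M 0 rfl (by simp) hMA
      simpa [Multiset.singleton_add] using this
    · refine PFrac.gen _ (by simpa using ⟨hLA, hMA⟩) ?_
      have : {v | v ∈ L ::ₘ M} = insert L {v | v ∈ M} := by ext; simp
      rw [this]
      exact hM.id_insert hL

theorem pfrac_all {k : ℕ} {A : Set (Fin k → ℝ)} (M : Multiset (Fin k → ℝ)) (hM : ∀ v ∈ M, v ∈ A) :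
    PFrac A (fun x => (denC M x)⁻¹) := by
  induction M using Multiset.induction_on with
  | empty => exact PFrac.gen 0 (by simp) (by simpa using linearIndepOn_empty ℝ id)
  | cons v M ih =>
    have := PFrac.inv_mul v (hM v (by simp)) _ (ih fun w hw => hM w (by simp [hw]))
    simpa [denC_cons, mul_comm] using this

/-- Decomposability into polar germs. -/
def Dec {k : ℕ} (A : Set (Fin k → ℝ)) (f : (Fin k → ℂ) → ℂ) : Prop :=
  ∃ (N : ℕ) (S : Fin N → PolarGerm k) (h : (Fin k → ℂ) → ℂ), AnalyticAt ℂ h 0 ∧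
    ∀ᶠ x in nhds (0 : Fin k → ℂ), GoodAt A x → (∀ j, (S j).Dom x) →
      f x = ∑ j, (S j).eval x + h x

theorem Dec.of_analytic {k : ℕ} {A : Set (Fin k → ℝ)} {f : (Fin k → ℂ) → ℂ}
    (hf : AnalyticAt ℂ f 0) : Dec A f :=
  ⟨0, Fin.elim0, f, hf, Eventually.of_forall fun x _ _ => by simp⟩

theorem Dec.of_polar {k : ℕ} {A : Set (Fin k → ℝ)} (S : PolarGerm k) : Dec A S.eval :=
  ⟨1, fun _ => S, fun _ => 0, analyticAt_const, Eventually.of_forall fun x _ _ => by simp⟩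

theorem Dec.add {k : ℕ} {A : Set (Fin k → ℝ)} {f g : (Fin k → ℂ) → ℂ}
    (hf : Dec A f) (hg : Dec A g) : Dec A (fun x => f x + g x) := by
  obtain ⟨N, S, h, hh, H⟩ := hf
  obtain ⟨N', S', h', hh', H'⟩ := hg
  refine ⟨N + N', Fin.append S S', fun x => h x + h' x, hh.add hh', ?_⟩
  filter_upwards [H, H'] with x h1 h2 hx hd
  rw [h1 hx fun j => by simpa using hd (Fin.castAdd N' j),
    h2 hx fun j => by simpa using hd (Fin.natAdd N j), Fin.sum_univ_add]
  simp only [Fin.append_left, Fin.append_right]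
  ring

theorem Dec.congr {k : ℕ} {A : Set (Fin k → ℝ)} {f g : (Fin k → ℂ) → ℂ}
    (hf : Dec A f) (h : ∀ᶠ x in nhds (0 : Fin k → ℂ), GoodAt A x → f x = g x) : Dec A g := by
  obtain ⟨N, S, r, hr, H⟩ := hf
  refine ⟨N, S, r, hr, ?_⟩
  filter_upwards [H, h] with x h1 h2 hx hd
  rw [← h2 hx, h1 hx hd]

theorem Dec.sum {k : ℕ} {A : Set (Fin k → ℝ)} {ι : Type*} (s : Finset ι)
    (F : ι → (Fin k → ℂ) → ℂ) (h : ∀ i ∈ s, Dec A (F i)) : Dec A (fun x => ∑ i ∈ s, F i x) := by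
  classical
  induction s using Finset.induction_on with
  | empty => simpa using Dec.of_analytic analyticAt_const
  | insert a s ha ih =>
    simp only [Finset.sum_insert ha]
    exact Dec.add (h a (by simp)) (ih fun i hi => h i (by simp [hi]))

def pairCL {k : ℕ} (v : Fin k → ℝ) : (Fin k → ℂ) →L[ℂ] ℂ :=
  ∑ i, (v i : ℂ) • ContinuousLinearMap.proj (R := ℂ) (φ := fun _ : Fin k => ℂ) i

theorem pairCL_apply {k : ℕ} (v : Fin k → ℝ) (x : Fin k → ℂ) : pairCL v x = pairC v x := by
  simp [pairCL, pairC]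

theorem dec_indep {k : ℕ} {A : Set (Fin k → ℝ)} (n : ℕ) :
    ∀ (M : Multiset (Fin k → ℝ)), M.card = n → (∀ v ∈ M, v ∈ A) →
      LinearIndepOn ℝ id {v | v ∈ M} → ∀ g : (Fin k → ℂ) → ℂ, AnalyticAt ℂ g 0 →
      Dec A (fun x => g x * (denC M x)⁻¹) := by
  classical
  induction n with
  | zero =>
    intro M hM _ _ g hg
    rw [Multiset.card_eq_zero] at hM
    subst hM
    simpa [denC] using Dec.of_analytic hg
  | succ n ih =>
    intro M hM hMA hMi g hg
    have hset : {v | v ∈ M} = (M.toFinset : Set (Fin k → ℝ)) := by ext; simp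
    have hMi' := hMi
    rw [hset] at hMi'
    obtain ⟨m, ell, hell, horth, w, u, hx⟩ := exists_split M.toFinset hMi'
    let W : (Fin m → ℂ) →L[ℂ] (Fin k → ℂ) :=
      ∑ i, (ContinuousLinearMap.proj (R := ℂ) (φ := fun _ : Fin m => ℂ) i).smulRight (w i)
    have hW : ∀ y, W y = ∑ i, y i • w i := by intro y; simp [W]
    let P : (Fin k → ℂ) →L[ℂ] (Fin m → ℂ) := ContinuousLinearMap.pi fun i => pairCL (ell i)
    have hP : ∀ x, P x = fun i => pairC (ell i) x := by
      intro x; funext i; simp [P, pairCL_apply]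
    obtain ⟨G, hG, hgG⟩ := hadamard g hg (W.comp P)
      (fun (v : M.toFinset) x => pairC (v : Fin k → ℝ) x) u (by
        intro x
        rw [ContinuousLinearMap.comp_apply, hW, hP]
        nth_rewrite 1 [hx x]
        simp)
    let e := M.toFinset.equivFin
    let S : PolarGerm k :=
      { m := m
        p := M.toFinset.card
        num := fun y => g (W y)
        num_analytic := by
          refine AnalyticAt.fun_comp ?_ (W.analyticAt 0)
          simpa using hg
        ell := ell
        L := fun j => (e.symm j : Fin k → ℝ)
        s := fun j => M.count (e.symm j : Fin k → ℝ)
        s_pos := fun j => Multiset.one_le_count_iff_mem.2 (Multiset.mem_toFinset.1 (e.symm j).2)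
        ell_indep := hell
        L_indep := by
          have h : LinearIndependent ℝ (fun v : M.toFinset => (v : Fin k → ℝ)) := hMi'
          exact h.comp e.symm e.symm.injective
        orth := fun i j => horth i _ (e.symm j).2 }
    have hS : ∀ x, S.eval x = g (W (P x)) * (denC M x)⁻¹ := by
      intro x
      have h1 : denC M x = ∏ j, pairC (S.L j) x ^ S.s j := by
        rw [denC, Finset.prod_multiset_map_count, ← Finset.prod_coe_sort]
        exact (Equiv.prod_comp e.symm
          (fun v : M.toFinset => pairC (v : Fin k → ℝ) x ^ M.count (v : Fin k → ℝ))).symm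
      rw [PolarGerm.eval, h1, hP, div_eq_mul_inv]
    have h1 : Dec A (fun x => ∑ v : M.toFinset, G v x * (denC (M.erase v) x)⁻¹) := by
      refine Dec.sum _ _ fun v _ => ?_
      have hv : (v : Fin k → ℝ) ∈ M := Multiset.mem_toFinset.1 v.2
      refine ih (M.erase v) (by rw [Multiset.card_erase_of_mem hv, hM]; rfl)
        (fun w hw => hMA w (Multiset.mem_of_mem_erase hw)) (hMi.mono ?_) _ (hG v)
      intro w hw
      exact Multiset.mem_of_mem_erase hw
    refine ((Dec.of_polar S).add h1).congr ?_
    filter_upwards [hgG] with x hgx hgood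
    rw [hgx, add_mul, hS, Finset.sum_mul]
    congr 1
    refine Finset.sum_congr rfl fun v _ => ?_
    have hv : (v : Fin k → ℝ) ∈ M := Multiset.mem_toFinset.1 v.2
    have hv0 := hgood v (hMA v hv)
    rw [denC_erase hv, mul_inv]
    field_simp

theorem PFrac.dec {k : ℕ} {A : Set (Fin k → ℝ)} {f : (Fin k → ℂ) → ℂ} (hf : PFrac A f) :
    ∀ g : (Fin k → ℂ) → ℂ, AnalyticAt ℂ g 0 → Dec A (fun x => g x * f x) := by
  induction hf with
  | zero => intro g _; simpa using Dec.of_analytic analyticAt_const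
  | add f f' _ _ h h' =>
    intro g hg; simp only [mul_add]; exact (h g hg).add (h' g hg)
  | smul c f _ h =>
    intro g hg
    have := h (fun x => g x * c) (hg.mul analyticAt_const)
    simpa [mul_assoc] using this
  | gen M hMA hM => intro g hg; exact dec_indep _ M rfl hMA hM g hg
  | congr f f' _ h hf =>
    intro g hg
    exact (hf g hg).congr (Eventually.of_forall fun x hx => by rw [h x hx])

/-- Every meromorphic germ at zero on `ℂ^k` with linear poles (i.e. `f ⋅ ∏ L_i` extends
holomorphically at zero for some nonzero real linear forms `L_i`) can be written as a
finite sum of polar germs plus a holomorphic germ at zero. -/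
theorem stmt4 (k : ℕ) (f : (Fin k → ℂ) → ℂ)
    (n : ℕ) (L : Fin n → Fin k → ℝ) (hL : ∀ i, L i ≠ 0)
    (g : (Fin k → ℂ) → ℂ) (hg : AnalyticAt ℂ g 0)
    (hf : ∀ᶠ x in nhds (0 : Fin k → ℂ), (∀ i, pairC (L i) x ≠ 0) →
      f x * ∏ i, pairC (L i) x = g x) :
    ∃ (N : ℕ) (S : Fin N → PolarGerm k) (h : (Fin k → ℂ) → ℂ),
      AnalyticAt ℂ h 0 ∧
      ∀ᶠ x in nhds (0 : Fin k → ℂ),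
        ((∀ i, pairC (L i) x ≠ 0) ∧ ∀ j, (S j).Dom x) →
          f x = ∑ j, (S j).eval x + h x := by
  have hD := (pfrac_all (A := Set.range L) (Finset.univ.val.map L) (by simp)).dec g hg
  have hden : ∀ x, denC (Finset.univ.val.map L) x = ∏ i, pairC (L i) x := by
    intro x; rw [denC, Multiset.map_map]; rfl
  have hD' : Dec (Set.range L) f := by
    refine hD.congr ?_
    filter_upwards [hf] with x hx hgood
    have h0 : ∀ i, pairC (L i) x ≠ 0 := fun i => hgood _ ⟨i, rfl⟩
    have h1 : ∏ i, pairC (L i) x ≠ 0 := Finset.prod_ne_zero_iff.2 fun i _ => h0 i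
    rw [hden, ← hx h0, mul_inv_cancel_right₀ h1]
  obtain ⟨N, S, h, hh, H⟩ := hD'
  refine ⟨N, S, h, hh, ?_⟩
  filter_upwards [H] with x hx hx'
  refine hx ?_ hx'.2
  rintro _ ⟨i, rfl⟩
  exact hx'.1 i

end
end

section
/- Let Δ be a finite set of nonzero vectors spanning a subspace U of dimension r, and let R_Δ be the ring of rational functions with denominators products of elements of Δ. Define G_Δ as the span of fractions 1/Π_{α∈κ} α^{n_α} over generating subsets κ ⊆ Δ (i.e., span(κ) = U) with n_α ≥ 1, and NG_Δ as the span of fractions h/Π_{α∈κ} α^{n_α} over non-generating subsets κ with h polynomial. Then R_Δ = G_Δ ⊕ NG_Δ. -/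
open Finset

noncomputable section

/-- The field of rational functions on `U* = (ℝ^r)*`: the fraction field of the symmetric
algebra `S(U)`, realized as the fraction field of the polynomial ring in `r` variables. -/
abbrev RatFun (r : ℕ) := FractionRing (MvPolynomial (Fin r) ℝ)

/-- The linear form on `U*` corresponding to a vector `α ∈ U = ℝ^r`, viewed inside the
field of rational functions. -/
def lin {r : ℕ} (α : Fin r → ℝ) : RatFun r :=
  algebraMap (MvPolynomial (Fin r) ℝ) (RatFun r)
    (∑ i, MvPolynomial.C (α i) * MvPolynomial.X i)

/-- `R_Δ = Δ⁻¹S(U)`: rational functions with denominators products of elements of `Δ`. -/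
def RDelta {r : ℕ} (Δ : Finset (Fin r → ℝ)) : Submodule ℝ (RatFun r) :=
  Submodule.span ℝ
    {f | ∃ (q : MvPolynomial (Fin r) ℝ) (m : (Fin r → ℝ) → ℕ),
      f = algebraMap (MvPolynomial (Fin r) ℝ) (RatFun r) q * (∏ α ∈ Δ, lin α ^ m α)⁻¹}

/-- `G_Δ`: the span of fractions `1/∏_{α ∈ κ} α^{n_α}` over generating subsets `κ ⊆ Δ`
(i.e. `span(κ) = U`) with exponents `n_α ≥ 1`. -/
def GDelta {r : ℕ} (Δ : Finset (Fin r → ℝ)) : Submodule ℝ (RatFun r) :=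
  Submodule.span ℝ
    {f | ∃ κ ⊆ Δ, Submodule.span ℝ (κ : Set (Fin r → ℝ)) = ⊤ ∧
      ∃ m : (Fin r → ℝ) → ℕ, (∀ α ∈ κ, 1 ≤ m α) ∧ f = (∏ α ∈ κ, lin α ^ m α)⁻¹}

/-- `NG_Δ`: the span of fractions `h/∏_{α ∈ κ} α^{n_α}` over non-generating subsets
`κ ⊆ Δ` with `h` polynomial. -/
def NGDelta {r : ℕ} (Δ : Finset (Fin r → ℝ)) : Submodule ℝ (RatFun r) :=
  Submodule.span ℝ
    {f | ∃ κ ⊆ Δ, Submodule.span ℝ (κ : Set (Fin r → ℝ)) ≠ ⊤ ∧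
      ∃ (q : MvPolynomial (Fin r) ℝ) (m : (Fin r → ℝ) → ℕ),
        f = algebraMap (MvPolynomial (Fin r) ℝ) (RatFun r) q * (∏ α ∈ κ, lin α ^ m α)⁻¹}

section helpers

open Polynomial in
/-- A wronskian-type lemma. -/
lemma aux_wronskian {A : Type*} [CommRing A] [IsDomain A] [CharZero A] (a b : A[X])
    (hd : a.degree < b.degree) (h : derivative a * b = a * derivative b) : a = 0 := by
  by_contra ha
  have hb : b ≠ 0 := by
    rintro rfl
    simp at hd
  have hn : a.natDegree < b.natDegree := natDegree_lt_natDegree ha hd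
  have h1 := congrArg leadingCoeff h
  rw [leadingCoeff_mul, leadingCoeff_mul, leadingCoeff_derivative, leadingCoeff_derivative] at h1
  have hla : a.leadingCoeff ≠ 0 := leadingCoeff_ne_zero.2 ha
  have hlb : b.leadingCoeff ≠ 0 := leadingCoeff_ne_zero.2 hb
  have h2 : ((a.natDegree : A) - b.natDegree) * (a.leadingCoeff * b.leadingCoeff) = 0 := by
    linear_combination h1
  rcases mul_eq_zero.1 h2 with h3 | h3
  · have : (a.natDegree : A) = b.natDegree := sub_eq_zero.1 h3
    have := Nat.cast_injective this
    omega
  · exact mul_ne_zero hla hlb h3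

lemma aux_deg {A : Type*} [CommRing A] [IsDomain A] {a b c : Polynomial A}
    (hc : c ≠ 0) (h : a.degree < b.degree) : (a * c).degree < (b * c).degree := by
  rw [Polynomial.degree_mul, Polynomial.degree_mul, Polynomial.degree_eq_natDegree hc]
  exact WithBot.add_lt_add_right WithBot.coe_ne_bot h

variable {r : ℕ}

lemma alg_smul (c : ℝ) (p : MvPolynomial (Fin r) ℝ) :
    algebraMap (MvPolynomial (Fin r) ℝ) (RatFun r) (c • p) =
      c • algebraMap (MvPolynomial (Fin r) ℝ) (RatFun r) p :=
  map_smul (IsScalarTower.toAlgHom ℝ (MvPolynomial (Fin r) ℝ) (RatFun r)) c p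

/-- the polynomial linear form -/
def linP (α : Fin r → ℝ) : MvPolynomial (Fin r) ℝ :=
  ∑ i, MvPolynomial.C (α i) * MvPolynomial.X i

lemma lin_eq (α : Fin r → ℝ) :
    lin α = algebraMap (MvPolynomial (Fin r) ℝ) (RatFun r) (linP α) := rfl

lemma linP_single (i : Fin r) : linP (Pi.single i (1 : ℝ)) = MvPolynomial.X i := by
  classical
  unfold linP
  rw [Finset.sum_eq_single i]
  · simp
  · intro j _ hj
    simp [hj]
  · simp

/-- `linP` as a linear map. -/
def linPL : (Fin r → ℝ) →ₗ[ℝ] MvPolynomial (Fin r) ℝ where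
  toFun := linP
  map_add' x y := by simp [linP, add_mul, Finset.sum_add_distrib]
  map_smul' c x := by
    simp only [linP, RingHom.id_apply, Finset.smul_sum, MvPolynomial.smul_eq_C_mul, mul_assoc,
      Pi.smul_apply, smul_eq_mul, map_mul]

lemma linP_ne_zero {α : Fin r → ℝ} (h : α ≠ 0) : linP α ≠ 0 := by
  classical
  intro h1
  apply h
  funext i
  have := congrArg (MvPolynomial.eval (Pi.single i (1 : ℝ))) h1
  simpa [linP, Pi.single_apply] using this

lemma algMap_inj : Function.Injective (algebraMap (MvPolynomial (Fin r) ℝ) (RatFun r)) :=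
  IsFractionRing.injective _ _

lemma lin_ne_zero {α : Fin r → ℝ} (h : α ≠ 0) : lin α ≠ 0 := by
  rw [lin_eq]
  intro h1
  exact linP_ne_zero h (algMap_inj (by rw [h1, map_zero]))

lemma dual_eq_sum (f : (Fin r → ℝ) →ₗ[ℝ] ℝ) (α : Fin r → ℝ) :
    f α = ∑ i, α i * f (Pi.single i 1) := by
  classical
  conv_lhs => rw [← Finset.univ_sum_single α]
  rw [map_sum]
  refine Finset.sum_congr rfl fun i _ => ?_
  rw [← smul_eq_mul, ← map_smul, ← Pi.single_smul, smul_eq_mul, mul_one]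

/-- infinitesimal translation on polynomials -/
def psi0 (f : (Fin r → ℝ) →ₗ[ℝ] ℝ) : MvPolynomial (Fin r) ℝ →ₐ[ℝ] DualNumber (RatFun r) :=
  MvPolynomial.aeval fun i =>
    TrivSqZeroExt.inl (algebraMap (MvPolynomial (Fin r) ℝ) (RatFun r) (MvPolynomial.X i)) +
      TrivSqZeroExt.inr (algebraMap ℝ (RatFun r) (f (Pi.single i 1)))

lemma psi0_fst (f : (Fin r → ℝ) →ₗ[ℝ] ℝ) (p : MvPolynomial (Fin r) ℝ) :
    (psi0 f p).fst = algebraMap (MvPolynomial (Fin r) ℝ) (RatFun r) p := by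
  have : ((TrivSqZeroExt.fstHom ℝ (RatFun r) (RatFun r)).comp (psi0 f)) =
      IsScalarTower.toAlgHom ℝ (MvPolynomial (Fin r) ℝ) (RatFun r) := by
    apply MvPolynomial.algHom_ext
    intro i
    simp [psi0]
  exact DFunLike.congr_fun this p

/-- infinitesimal translation on rational functions -/
def psi (f : (Fin r → ℝ) →ₗ[ℝ] ℝ) : RatFun r →ₐ[ℝ] DualNumber (RatFun r) :=
  IsLocalization.liftAlgHom (M := nonZeroDivisors (MvPolynomial (Fin r) ℝ)) (f := psi0 f) (by
    intro y
    rw [TrivSqZeroExt.isUnit_iff_isUnit_fst, psi0_fst, isUnit_iff_ne_zero]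
    intro h
    exact nonZeroDivisors.ne_zero y.2 (algMap_inj (by rw [h, map_zero])))

lemma psi_alg (f : (Fin r → ℝ) →ₗ[ℝ] ℝ) (p : MvPolynomial (Fin r) ℝ) :
    psi f (algebraMap (MvPolynomial (Fin r) ℝ) (RatFun r) p) = psi0 f p := by
  simp [psi]

lemma psi_fst (f : (Fin r → ℝ) →ₗ[ℝ] ℝ) (g : RatFun r) : (psi f g).fst = g := by
  obtain ⟨p, q, hq, rfl⟩ := IsFractionRing.div_surjective (A := MvPolynomial (Fin r) ℝ) g
  have hq' : algebraMap (MvPolynomial (Fin r) ℝ) (RatFun r) q ≠ 0 := by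
    intro h
    exact nonZeroDivisors.ne_zero hq (algMap_inj (by rw [h, map_zero]))
  have := congrArg (fun g => (psi f g).fst) (div_mul_cancel₀ (algebraMap (MvPolynomial (Fin r) ℝ) (RatFun r) p) hq')
  simp only [map_mul, TrivSqZeroExt.fst_mul, psi_alg, psi0_fst] at this
  rw [eq_div_iff hq', this]

/-- directional derivative on rational functions -/
def DD (f : (Fin r → ℝ) →ₗ[ℝ] ℝ) : Derivation ℝ (RatFun r) (RatFun r) :=
  Derivation.mk' ((TrivSqZeroExt.sndHom (RatFun r) (RatFun r)).restrictScalars ℝ ∘ₗ (psi f).toLinearMap) (by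
    intro a b
    simp [TrivSqZeroExt.snd_mul, psi_fst, mul_comm])

/-- directional derivative on polynomials -/
def DP (f : (Fin r → ℝ) →ₗ[ℝ] ℝ) :
    Derivation ℝ (MvPolynomial (Fin r) ℝ) (MvPolynomial (Fin r) ℝ) :=
  MvPolynomial.mkDerivation ℝ fun i => MvPolynomial.C (f (Pi.single i 1))

lemma DD_alg (f : (Fin r → ℝ) →ₗ[ℝ] ℝ) (p : MvPolynomial (Fin r) ℝ) :
    DD f (algebraMap (MvPolynomial (Fin r) ℝ) (RatFun r) p) =
      algebraMap (MvPolynomial (Fin r) ℝ) (RatFun r) (DP f p) := by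
  induction p using MvPolynomial.induction_on with
  | C a =>
    have h1 : algebraMap (MvPolynomial (Fin r) ℝ) (RatFun r) (MvPolynomial.C a) =
      algebraMap ℝ (RatFun r) a := by
      rw [IsScalarTower.algebraMap_apply ℝ (MvPolynomial (Fin r) ℝ) (RatFun r)]
      rfl
    rw [h1, Derivation.map_algebraMap]
    simp [DP]
  | add p q hp hq => simp only [map_add, hp, hq]
  | mul_X p i hp =>
    have hX : DD f (algebraMap (MvPolynomial (Fin r) ℝ) (RatFun r) (MvPolynomial.X i)) =
      algebraMap (MvPolynomial (Fin r) ℝ) (RatFun r) (DP f (MvPolynomial.X i)) := by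
      have : DD f (algebraMap (MvPolynomial (Fin r) ℝ) (RatFun r) (MvPolynomial.X i)) =
        (psi f (algebraMap (MvPolynomial (Fin r) ℝ) (RatFun r) (MvPolynomial.X i))).snd := rfl
      rw [this, psi_alg]
      simp only [psi0, DP, MvPolynomial.aeval_X, MvPolynomial.mkDerivation_X,
        TrivSqZeroExt.snd_add, TrivSqZeroExt.snd_inl, TrivSqZeroExt.snd_inr, zero_add]
      rw [IsScalarTower.algebraMap_apply ℝ (MvPolynomial (Fin r) ℝ) (RatFun r)]
      rfl
    rw [map_mul, Derivation.leibniz, Derivation.leibniz, hX, hp]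
    simp only [smul_eq_mul, map_add, map_mul]

lemma DP_linP (f : (Fin r → ℝ) →ₗ[ℝ] ℝ) (α : Fin r → ℝ) :
    DP f (linP α) = MvPolynomial.C (f α) := by
  rw [dual_eq_sum f α]
  simp [linP, DP, Derivation.leibniz, map_sum]

lemma DD_lin (f : (Fin r → ℝ) →ₗ[ℝ] ℝ) (α : Fin r → ℝ) :
    DD f (lin α) = algebraMap ℝ (RatFun r) (f α) := by
  rw [lin_eq, DD_alg, DP_linP, IsScalarTower.algebraMap_apply ℝ (MvPolynomial (Fin r) ℝ) (RatFun r)]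
  rfl

open Polynomial in
/-- finite translation `p(x) ↦ p(x + t ξ)` -/
def phi (f : (Fin r → ℝ) →ₗ[ℝ] ℝ) :
    MvPolynomial (Fin r) ℝ →ₐ[ℝ] Polynomial (MvPolynomial (Fin r) ℝ) :=
  MvPolynomial.aeval fun i =>
    Polynomial.C (MvPolynomial.X i) +
      Polynomial.C (MvPolynomial.C (f (Pi.single i 1))) * Polynomial.X

lemma phi_C (f : (Fin r → ℝ) →ₗ[ℝ] ℝ) (a : ℝ) :
    phi f (MvPolynomial.C a) = Polynomial.C (MvPolynomial.C a) := by
  simp [phi]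

lemma phi_derivative (f : (Fin r → ℝ) →ₗ[ℝ] ℝ) (p : MvPolynomial (Fin r) ℝ) :
    Polynomial.derivative (phi f p) = phi f (DP f p) := by
  induction p using MvPolynomial.induction_on with
  | C a =>
    rw [phi_C]
    simp [DP]
  | add p q hp hq => simp only [map_add, hp, hq]
  | mul_X p i hp =>
    have hX : DP f (MvPolynomial.X i) = MvPolynomial.C (f (Pi.single i 1)) := by
      simp [DP]
    rw [map_mul, Derivation.leibniz, hX, Polynomial.derivative_mul, hp]
    simp only [smul_eq_mul, map_add, map_mul, phi_C]
    simp [phi]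
    ring

lemma phi_linP (f : (Fin r → ℝ) →ₗ[ℝ] ℝ) (α : Fin r → ℝ) :
    phi f (linP α) = Polynomial.C (MvPolynomial.C (f α)) * Polynomial.X + Polynomial.C (linP α) := by
  rw [dual_eq_sum f α]
  conv_lhs => rw [linP]
  simp only [map_sum, map_mul, phi_C, linP, Finset.sum_mul, ← Finset.sum_add_distrib]
  refine Finset.sum_congr rfl fun i _ => ?_
  simp only [phi, MvPolynomial.aeval_X]
  ring

lemma phi_inj (f : (Fin r → ℝ) →ₗ[ℝ] ℝ) (p : MvPolynomial (Fin r) ℝ) (h : phi f p = 0) :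
    p = 0 := by
  have : ((Polynomial.aeval (R := MvPolynomial (Fin r) ℝ) (0 : MvPolynomial (Fin r) ℝ)).restrictScalars ℝ).comp (phi f) =
      AlgHom.id ℝ _ := by
    apply MvPolynomial.algHom_ext
    intro i
    simp [phi]
  have h2 := DFunLike.congr_fun this p
  simp only [AlgHom.comp_apply, h, map_zero] at h2
  exact h2.symm

/-- rational functions vanishing at infinity in the given direction -/
def MM (f : (Fin r → ℝ) →ₗ[ℝ] ℝ) : Submodule ℝ (RatFun r) where
  carrier := {g | ∃ p q : MvPolynomial (Fin r) ℝ, (phi f p).degree < (phi f q).degree ∧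
    g * algebraMap (MvPolynomial (Fin r) ℝ) (RatFun r) q = algebraMap (MvPolynomial (Fin r) ℝ) (RatFun r) p}
  zero_mem' := ⟨0, 1, by simp, by simp⟩
  add_mem' := by
    rintro a b ⟨p, q, h, e⟩ ⟨p', q', h', e'⟩
    refine ⟨p * q' + p' * q, q * q', ?_, ?_⟩
    · have hq : phi f q ≠ 0 := by
        intro h0
        simp [h0] at h
      have hq' : phi f q' ≠ 0 := by
        intro h0
        simp [h0] at h'
      simp only [map_add, map_mul]
      refine lt_of_le_of_lt (Polynomial.degree_add_le _ _) (max_lt ?_ ?_)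
      · exact aux_deg hq' h
      · rw [mul_comm (phi f q)]
        exact aux_deg hq h'
    · simp only [map_add, map_mul, ← e, ← e']
      ring
  smul_mem' := by
    rintro c a ⟨p, q, h, e⟩
    refine ⟨c • p, q, ?_, ?_⟩
    · rw [map_smul]
      exact lt_of_le_of_lt (Polynomial.degree_smul_le _ _) h
    · rw [smul_mul_assoc, e, alg_smul]

lemma MM_inj (f : (Fin r → ℝ) →ₗ[ℝ] ℝ) (g : RatFun r) (hg : g ∈ MM f) (hD : DD f g = 0) :
    g = 0 := by
  obtain ⟨p, q, h, e⟩ := hg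
  have hq : q ≠ 0 := by
    rintro rfl
    simp at h
  have hq' : algebraMap (MvPolynomial (Fin r) ℝ) (RatFun r) q ≠ 0 := fun h =>
    hq (algMap_inj (by rw [h, map_zero]))
  have h1 := congrArg (DD f) e
  rw [Derivation.leibniz, hD, DD_alg, DD_alg, smul_zero, add_zero, smul_eq_mul] at h1
  have h2 : DP f p * q = p * DP f q := by
    apply algMap_inj
    rw [map_mul, map_mul, ← h1, ← e]
    ring
  have h3 := congrArg (phi f) h2
  rw [map_mul, map_mul, ← phi_derivative, ← phi_derivative] at h3
  have h4 := phi_inj f p (aux_wronskian _ _ h h3)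
  rw [h4, map_zero] at e
  exact (mul_eq_zero.1 e).resolve_right hq'

lemma exists_ne_of_span {κ : Finset (Fin r → ℝ)}
    (hs : Submodule.span ℝ (κ : Set (Fin r → ℝ)) = ⊤) {f : (Fin r → ℝ) →ₗ[ℝ] ℝ} (hf : f ≠ 0) :
    ∃ α ∈ κ, f α ≠ 0 := by
  by_contra! h
  apply hf
  have : Submodule.span ℝ (κ : Set (Fin r → ℝ)) ≤ LinearMap.ker f :=
    Submodule.span_le.2 fun α hα => h α hα
  rw [hs, top_le_iff] at this
  exact LinearMap.ker_eq_top.1 this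

lemma GDelta_le_MM {Δ : Finset (Fin r → ℝ)} (h0 : (0 : Fin r → ℝ) ∉ Δ)
    {f : (Fin r → ℝ) →ₗ[ℝ] ℝ} (hf : f ≠ 0) : GDelta Δ ≤ MM f := by
  refine Submodule.span_le.2 ?_
  rintro g ⟨κ, hκ, hs, m, hm, rfl⟩
  have hne : ∀ α ∈ κ, α ≠ 0 := fun α hα h => h0 (h ▸ hκ hα)
  refine ⟨1, ∏ α ∈ κ, linP α ^ m α, ?_, ?_⟩
  · obtain ⟨α, hα, hfα⟩ := exists_ne_of_span hs hf
    rw [map_one, Polynomial.degree_one, ← Polynomial.natDegree_pos_iff_degree_pos, map_prod,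
      Polynomial.natDegree_prod]
    · refine Finset.sum_pos' (fun _ _ => Nat.zero_le _) ⟨α, hα, ?_⟩
      rw [map_pow, Polynomial.natDegree_pow, phi_linP, Polynomial.natDegree_linear]
      · have := hm α hα
        omega
      · simpa using hfα
    · intro β hβ
      rw [map_pow]
      exact pow_ne_zero _ fun h => linP_ne_zero (hne β hβ) (phi_inj f _ h)
  · rw [map_one, map_prod]
    simp only [map_pow, ← lin_eq]
    apply inv_mul_cancel₀
    exact Finset.prod_ne_zero_iff.2 fun α hα => pow_ne_zero _ (lin_ne_zero (hne α hα))

lemma deriv_prod {K : Type*} [Field K] [Algebra ℝ K] {ι : Type*} [DecidableEq ι]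
    (D : Derivation ℝ K K) (s : Finset ι)
    (u : ι → K) : D (∏ i ∈ s, u i) = ∑ i ∈ s, D (u i) * ∏ j ∈ s.erase i, u j := by
  induction s using Finset.induction_on with
  | empty => simp
  | insert a s ha ih =>
    rw [Finset.prod_insert ha, Derivation.leibniz, ih, Finset.sum_insert ha,
      Finset.erase_insert ha, add_comm, smul_eq_mul, smul_eq_mul, mul_comm, Finset.mul_sum]
    congr 1
    refine Finset.sum_congr rfl fun i hi => ?_
    have hne : a ≠ i := fun h => ha (h ▸ hi)
    rw [Finset.erase_insert_of_ne hne, Finset.prod_insert (fun h => ha (Finset.mem_of_mem_erase h))]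
    ring

lemma DD_inv_prod [DecidableEq (Fin r → ℝ)] (f : (Fin r → ℝ) →ₗ[ℝ] ℝ) {κ : Finset (Fin r → ℝ)}
    (h0 : (0 : Fin r → ℝ) ∉ κ) (m : (Fin r → ℝ) → ℕ) :
    DD f (∏ α ∈ κ, lin α ^ m α)⁻¹ =
      ∑ α ∈ κ, (-(m α * f α)) • (∏ β ∈ κ, lin β ^ (Function.update m α (m α + 1) β))⁻¹ := by
  rw [← Finset.prod_inv_distrib, deriv_prod]
  refine Finset.sum_congr rfl fun α hα => ?_
  have hl : lin α ≠ 0 := lin_ne_zero fun h => h0 (h ▸ hα)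
  rw [← Finset.prod_inv_distrib, ← Finset.mul_prod_erase _ _ hα]
  have h1 : ∏ x ∈ κ.erase α, (lin x ^ Function.update m α (m α + 1) x)⁻¹ =
      ∏ x ∈ κ.erase α, (lin x ^ m x)⁻¹ := by
    refine Finset.prod_congr rfl fun x hx => ?_
    rw [Function.update_of_ne (Finset.ne_of_mem_erase hx)]
  rw [h1, Function.update_self, ← smul_mul_assoc]
  congr 1
  rw [Derivation.leibniz_inv, Derivation.leibniz_pow, DD_lin, Algebra.smul_def (-((m α : ℝ) * f α))]
  simp only [smul_eq_mul, nsmul_eq_mul, map_neg, map_mul, map_natCast]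
  rcases Nat.eq_zero_or_pos (m α) with h | h
  · simp [h]
  · obtain ⟨k, hk⟩ := Nat.exists_eq_succ_of_ne_zero h.ne'
    rw [hk]
    simp only [Nat.succ_eq_add_one, Nat.add_sub_cancel]
    field_simp
    try ring

lemma GDelta_stable {Δ : Finset (Fin r → ℝ)} (h0 : (0 : Fin r → ℝ) ∉ Δ)
    (f : (Fin r → ℝ) →ₗ[ℝ] ℝ) : GDelta Δ ≤ (GDelta Δ).comap (DD f).toLinearMap := by
  classical
  refine Submodule.span_le.2 ?_
  rintro g ⟨κ, hκ, hs, m, hm, rfl⟩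
  change DD f _ ∈ GDelta Δ
  rw [DD_inv_prod f (fun h => h0 (hκ h))]
  refine Submodule.sum_mem _ fun α hα => Submodule.smul_mem _ _ (Submodule.subset_span ?_)
  refine ⟨κ, hκ, hs, _, ?_, rfl⟩
  intro β hβ
  have := hm β hβ
  by_cases h : β = α
  · subst h
    simp
  · rwa [Function.update_of_ne h]

lemma RDelta_stable {κ : Finset (Fin r → ℝ)} (h0 : (0 : Fin r → ℝ) ∉ κ)
    (f : (Fin r → ℝ) →ₗ[ℝ] ℝ) : RDelta κ ≤ (RDelta κ).comap (DD f).toLinearMap := by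
  classical
  refine Submodule.span_le.2 ?_
  rintro g ⟨q, m, rfl⟩
  change DD f _ ∈ RDelta κ
  rw [Derivation.leibniz, DD_inv_prod f h0, DD_alg, smul_eq_mul, smul_eq_mul]
  refine Submodule.add_mem _ ?_ ?_
  · rw [Finset.mul_sum]
    refine Submodule.sum_mem _ fun α hα => ?_
    rw [mul_smul_comm]
    exact Submodule.smul_mem _ _ (Submodule.subset_span ⟨q, _, rfl⟩)
  · rw [mul_comm]
    exact Submodule.subset_span ⟨_, m, rfl⟩

lemma nilp_mul {K : Type*} [Field K] [Algebra ℝ K] (D : Derivation ℝ K K) (x : K) (c : ℝ)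
    (hx : D x = algebraMap ℝ K c) (n : ℕ) : ∀ p : K, (D.toLinearMap ^ n) p = 0 →
      (D.toLinearMap ^ (n + 1)) (p * x) = 0 := by
  induction n with
  | zero =>
    intro p hp
    have : p = 0 := by simpa using hp
    simp [this]
  | succ n ih =>
    intro p hp
    rw [pow_succ, Module.End.mul_apply] at hp ⊢
    have h1 : D.toLinearMap (p * x) = c • p + D.toLinearMap p * x := by
      change D (p * x) = c • p + D p * x
      rw [Derivation.leibniz, hx, Algebra.smul_def c, smul_eq_mul, smul_eq_mul]
      ring
    rw [h1, map_add, ih _ hp, map_smul, pow_succ, Module.End.mul_apply, hp]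
    simp

lemma nilp_poly (f : (Fin r → ℝ) →ₗ[ℝ] ℝ) (q : MvPolynomial (Fin r) ℝ) :
    algebraMap (MvPolynomial (Fin r) ℝ) (RatFun r) q ∈
      Module.End.maxGenEigenspace (DD f).toLinearMap 0 := by
  induction q using MvPolynomial.induction_on with
  | C a =>
    rw [Module.End.mem_maxGenEigenspace]
    refine ⟨1, ?_⟩
    simp only [zero_smul, sub_zero, pow_one]
    change DD f _ = 0
    rw [DD_alg]
    simp [DP]
  | add p q hp hq =>
    rw [map_add]
    exact Submodule.add_mem _ hp hq
  | mul_X p i hp =>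
    rw [Module.End.mem_maxGenEigenspace] at hp ⊢
    simp only [zero_smul, sub_zero] at hp ⊢
    obtain ⟨k, hk⟩ := hp
    refine ⟨k + 1, ?_⟩
    rw [map_mul]
    refine nilp_mul (DD f) _ (f (Pi.single i 1)) ?_ k _ hk
    rw [← linP_single, ← lin_eq, DD_lin]

lemma nilp_RDelta {κ : Finset (Fin r → ℝ)} (h0 : (0 : Fin r → ℝ) ∉ κ)
    (f : (Fin r → ℝ) →ₗ[ℝ] ℝ) (hf : ∀ α ∈ κ, f α = 0) :
    RDelta κ ≤ Module.End.maxGenEigenspace (DD f).toLinearMap 0 := by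
  classical
  refine Submodule.span_le.2 ?_
  rintro g ⟨q, m, rfl⟩
  have hP : DD f (∏ α ∈ κ, lin α ^ m α)⁻¹ = 0 := by
    rw [DD_inv_prod f h0]
    refine Finset.sum_eq_zero fun α hα => ?_
    simp [hf α hα]
  have hk := nilp_poly f q
  rw [SetLike.mem_coe]
  rw [Module.End.mem_maxGenEigenspace] at hk ⊢
  simp only [zero_smul, sub_zero] at hk ⊢
  obtain ⟨k, hk⟩ := hk
  refine ⟨k, ?_⟩
  generalize (∏ α ∈ κ, lin α ^ m α)⁻¹ = u at hP
  have key : ∀ (n : ℕ) (p : RatFun r),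
      ((DD f).toLinearMap ^ n) (p * u) = ((DD f).toLinearMap ^ n) p * u := by
    intro n
    induction n with
    | zero => simp
    | succ n ih =>
      intro p
      rw [pow_succ, Module.End.mul_apply, Module.End.mul_apply, ← ih]
      congr 1
      change DD f _ = DD f _ * _
      rw [Derivation.leibniz, hP, smul_zero, zero_add, smul_eq_mul, mul_comm]
  rw [key, hk, zero_mul]

lemma pow_inj_GDelta {Δ : Finset (Fin r → ℝ)} (h0 : (0 : Fin r → ℝ) ∉ Δ)
    {f : (Fin r → ℝ) →ₗ[ℝ] ℝ} (hf : f ≠ 0) (n : ℕ) : ∀ g ∈ GDelta Δ,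
      ((DD f).toLinearMap ^ n) g = 0 → g = 0 := by
  induction n with
  | zero =>
    intro g _ h
    simpa using h
  | succ n ih =>
    intro g hg h
    rw [pow_succ, Module.End.mul_apply] at h
    exact MM_inj f g (GDelta_le_MM h0 hf hg) (ih _ (GDelta_stable h0 f hg) h)

lemma pow_stable {K : Type*} [AddCommGroup K] [Module ℝ K] (D : Module.End ℝ K)
    (S : Submodule ℝ K) (h : S ≤ S.comap D) (n : ℕ) : ∀ g ∈ S, (D ^ n) g ∈ S := by
  induction n with
  | zero => simp
  | succ n ih =>
    intro g hg
    rw [pow_succ, Module.End.mul_apply]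
    exact ih _ (h hg)

lemma main_disjoint {Δ : Finset (Fin r → ℝ)} (h0 : (0 : Fin r → ℝ) ∉ Δ)
    (s : Finset (Finset (Fin r → ℝ))) :
    (∀ κ ∈ s, κ ⊆ Δ ∧ Submodule.span ℝ (κ : Set (Fin r → ℝ)) ≠ ⊤) →
    ∀ g ∈ GDelta Δ, g ∈ s.sup RDelta → g = 0 := by
  classical
  induction s using Finset.induction_on with
  | empty =>
    intro _ g _ h
    simpa using h
  | insert κ s hκ ih =>
    intro hs g hg h
    rw [Finset.sup_insert] at h
    obtain ⟨a, ha, b, hb, rfl⟩ := Submodule.mem_sup.1 h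
    obtain ⟨hκΔ, hκs⟩ := hs κ (Finset.mem_insert_self _ _)
    have hs' := fun κ' h' => hs κ' (Finset.mem_insert_of_mem h')
    obtain ⟨f, hf, hle⟩ := Submodule.exists_le_ker_of_lt_top _ (lt_top_iff_ne_top.2 hκs)
    have hnil := nilp_RDelta (fun h => h0 (hκΔ h)) f
      (fun α hα => hle (Submodule.subset_span hα)) ha
    rw [Module.End.mem_maxGenEigenspace] at hnil
    simp only [zero_smul, sub_zero] at hnil
    obtain ⟨k, hk⟩ := hnil
    refine pow_inj_GDelta h0 hf k _ hg (ih hs' _ (pow_stable _ _ (GDelta_stable h0 f) k _ hg) ?_)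
    rw [map_add, hk, zero_add]
    refine pow_stable _ _ (Finset.sup_le fun κ' h' => ?_) k _ hb
    exact (RDelta_stable (fun h => h0 ((hs' κ' h').1 h)) f).trans
      (Submodule.comap_mono (Finset.le_sup h'))

lemma prod_extend {Δ κ : Finset (Fin r → ℝ)} (hκ : κ ⊆ Δ) (m : (Fin r → ℝ) → ℕ) :
    ∃ m' : (Fin r → ℝ) → ℕ, ∏ α ∈ κ, lin α ^ m α = ∏ α ∈ Δ, lin α ^ m' α := by
  classical
  refine ⟨fun α => if α ∈ κ then m α else 0, ?_⟩
  rw [← Finset.prod_subset hκ]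
  · refine Finset.prod_congr rfl fun α hα => ?_
    simp [hα]
  · intro α _ hα
    simp [hα]

lemma prod_filter' {Δ : Finset (Fin r → ℝ)} (m : (Fin r → ℝ) → ℕ) :
    ∏ α ∈ Δ, lin α ^ m α = ∏ α ∈ Δ.filter (fun α => m α ≠ 0), lin α ^ m α := by
  symm
  refine Finset.prod_subset (Finset.filter_subset _ _) ?_
  intro α hα h
  have : m α = 0 := by
    by_contra h'
    exact h (Finset.mem_filter.2 ⟨hα, h'⟩)
  simp [this]

lemma main_sum {Δ : Finset (Fin r → ℝ)} (h0 : (0 : Fin r → ℝ) ∉ Δ)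
    (q : MvPolynomial (Fin r) ℝ) : ∀ m : (Fin r → ℝ) → ℕ,
      algebraMap (MvPolynomial (Fin r) ℝ) (RatFun r) q * (∏ α ∈ Δ, lin α ^ m α)⁻¹ ∈
        GDelta Δ ⊔ NGDelta Δ := by
  classical
  induction q using MvPolynomial.induction_on with
  | C a =>
    intro m
    rw [prod_filter']
    by_cases hs : Submodule.span ℝ ((Δ.filter (fun α => m α ≠ 0) : Finset _) : Set (Fin r → ℝ)) = ⊤
    · have h1 : algebraMap (MvPolynomial (Fin r) ℝ) (RatFun r) (MvPolynomial.C a) =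
        algebraMap ℝ (RatFun r) a := by
        rw [IsScalarTower.algebraMap_apply ℝ (MvPolynomial (Fin r) ℝ) (RatFun r)]
        rfl
      rw [h1, ← Algebra.smul_def]
      refine Submodule.mem_sup_left (Submodule.smul_mem _ _ (Submodule.subset_span ?_))
      refine ⟨_, Finset.filter_subset _ _, hs, m, fun α hα => ?_, rfl⟩
      have := (Finset.mem_filter.1 hα).2
      omega
    · exact Submodule.mem_sup_right (Submodule.subset_span
        ⟨_, Finset.filter_subset _ _, hs, _, m, rfl⟩)
  | add p q hp hq =>
    intro m
    rw [map_add, add_mul]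
    exact Submodule.add_mem _ (hp m) (hq m)
  | mul_X p i hp =>
    intro m
    by_cases hs : Submodule.span ℝ ((Δ.filter (fun α => m α ≠ 0) : Finset _) : Set (Fin r → ℝ)) = ⊤
    · have key : ∀ v ∈ Submodule.span ℝ ((Δ.filter (fun α => m α ≠ 0) : Finset _) : Set (Fin r → ℝ)),
          algebraMap (MvPolynomial (Fin r) ℝ) (RatFun r) (p * linPL v) *
            (∏ α ∈ Δ, lin α ^ m α)⁻¹ ∈ GDelta Δ ⊔ NGDelta Δ := by
        intro v hv
        induction hv using Submodule.span_induction with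
        | mem v hv =>
          obtain ⟨hvΔ, hmv⟩ := Finset.mem_filter.1 (Finset.mem_coe.1 hv)
          have hl : lin v ≠ 0 := lin_ne_zero fun h => h0 (h ▸ hvΔ)
          convert hp (Function.update m v (m v - 1)) using 1
          rw [map_mul, mul_assoc]
          congr 1
          change lin v * _ = _
          rw [← Finset.mul_prod_erase _ _ hvΔ, ← Finset.mul_prod_erase Δ _ hvΔ]
          have h1 : ∏ x ∈ Δ.erase v, lin x ^ Function.update m v (m v - 1) x =
              ∏ x ∈ Δ.erase v, lin x ^ m x := by
            refine Finset.prod_congr rfl fun x hx => ?_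
            rw [Function.update_of_ne (Finset.ne_of_mem_erase hx)]
          rw [h1, Function.update_self, mul_inv, mul_inv, ← mul_assoc]
          congr 1
          obtain ⟨k, hk⟩ := Nat.exists_eq_succ_of_ne_zero hmv
          rw [hk, Nat.succ_eq_add_one, Nat.add_sub_cancel, pow_succ, mul_inv_rev, ← mul_assoc,
            mul_inv_cancel₀ hl, one_mul]
        | zero => simp
        | add x y _ _ hx hy =>
          rw [map_add, mul_add, map_add, add_mul]
          exact Submodule.add_mem _ hx hy
        | smul c x _ hx =>
          rw [map_smul, mul_smul_comm, alg_smul, smul_mul_assoc]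
          exact Submodule.smul_mem _ _ hx
      have := key (Pi.single i 1) (hs ▸ Submodule.mem_top)
      rwa [show linPL (Pi.single i (1 : ℝ)) = MvPolynomial.X i from linP_single i] at this
    · rw [prod_filter']
      exact Submodule.mem_sup_right (Submodule.subset_span
        ⟨_, Finset.filter_subset _ _, hs, _, m, rfl⟩)

end helpers

/-- Brion–Vergne decomposition: for a finite set `Δ` of nonzero vectors spanning `U` (of
dimension `r`), `R_Δ = G_Δ ⊕ NG_Δ`. -/
theorem stmt19 (r : ℕ) (Δ : Finset (Fin r → ℝ))
    (h0 : (0 : Fin r → ℝ) ∉ Δ)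
    (hspan : Submodule.span ℝ ((Δ : Set (Fin r → ℝ))) = ⊤) :
    Disjoint (GDelta Δ) (NGDelta Δ) ∧ GDelta Δ ⊔ NGDelta Δ = RDelta Δ := by
  classical
  constructor
  · rw [Submodule.disjoint_def]
    intro g hg hn
    refine main_disjoint h0 (Δ.powerset.filter fun κ : Finset (Fin r → ℝ) =>
      Submodule.span ℝ (κ : Set (Fin r → ℝ)) ≠ ⊤) ?_ g hg ?_
    · intro κ hκ
      simpa using hκ
    · refine (Submodule.span_le.2 ?_ : NGDelta Δ ≤ _) hn
      rintro f ⟨κ, hκ, hs, q, m, rfl⟩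
      have hle : RDelta κ ≤ (Δ.powerset.filter fun κ : Finset (Fin r → ℝ) =>
          Submodule.span ℝ (κ : Set (Fin r → ℝ)) ≠ ⊤).sup RDelta :=
        Finset.le_sup (f := RDelta) (Finset.mem_filter.2 ⟨Finset.mem_powerset.2 hκ, hs⟩)
      exact hle (Submodule.subset_span ⟨q, m, rfl⟩)
  · apply le_antisymm
    · refine sup_le (Submodule.span_le.2 ?_) (Submodule.span_le.2 ?_)
      · rintro f ⟨κ, hκ, hs, m, hm, rfl⟩
        obtain ⟨m', hm'⟩ := prod_extend hκ m
        exact Submodule.subset_span ⟨1, m', by rw [hm', map_one, one_mul]⟩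
      · rintro f ⟨κ, hκ, hs, q, m, rfl⟩
        obtain ⟨m', hm'⟩ := prod_extend hκ m
        exact Submodule.subset_span ⟨q, m', by rw [hm']⟩
    · refine Submodule.span_le.2 ?_
      rintro f ⟨q, m, rfl⟩
      exact main_sum h0 q m

end
end
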